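/- Let S be a positive semidefinite Hermitian operator on H_{A_I}⊗H_{A_O}⊗H_{B_I}⊗H_{B_O} with S ∈ L_s ∩ L_V. Then for every real λ ≥ 2·Tr(S), the operator S + λI belongs to coni(S_definite). In particular, if S satisfies the normalization Tr(S) = d_A·d_{B_I} of a setup operator, then S + λI ∈ coni(S_definite) for all λ ≥ 2·d_A·d_{B_I}. -/

import Mathlib

open Matrix
open scoped ComplexOrder

namespace InOutIndef

/-- Index set of `H_{A_I} ⊗ H_{A_O} ⊗ H_{B_I} ⊗ H_{B_O}`, with
`dim H_{A_I} = dim H_{A_O} = dA`, `dim H_{B_I} = dBI`, `dim H_{B_O} = dBO`. -/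
abbrev Idx4 (dA dBI dBO : ℕ) := Fin dA × Fin dA × Fin dBI × Fin dBO

/-- Operators on `H_{A_I} ⊗ H_{A_O} ⊗ H_{B_I} ⊗ H_{B_O}`. -/
abbrev Mat4 (dA dBI dBO : ℕ) := Matrix (Idx4 dA dBI dBO) (Idx4 dA dBI dBO) ℂ

variable (dA dBI dBO : ℕ)

/-- Partial trace `Tr_{A_I A_O B_O}`. -/
noncomputable def trAIAOBO (M : Mat4 dA dBI dBO) : Matrix (Fin dBI) (Fin dBI) ℂ :=
  Matrix.of fun bi bi' => ∑ ai : Fin dA, ∑ ao : Fin dA, ∑ bo : Fin dBO,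
    M (ai, ao, bi, bo) (ai, ao, bi', bo)

/-- Partial trace `Tr_{B_O}`. -/
noncomputable def trBO (M : Mat4 dA dBI dBO) :
    Matrix (Fin dA × Fin dA × Fin dBI) (Fin dA × Fin dA × Fin dBI) ℂ :=
  Matrix.of fun p q => ∑ bo : Fin dBO, M (p.1, p.2.1, p.2.2, bo) (q.1, q.2.1, q.2.2, bo)

/-- Partial trace `Tr_{A_O B_O}` (remaining factors: `A_I`, `B_I`). -/
noncomputable def trAOBO (M : Mat4 dA dBI dBO) :
    Matrix (Fin dA × Fin dBI) (Fin dA × Fin dBI) ℂ :=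
  Matrix.of fun p q => ∑ ao : Fin dA, ∑ bo : Fin dBO, M (p.1, ao, p.2, bo) (q.1, ao, q.2, bo)

/-- Partial trace `Tr_{A_I B_O}` (remaining factors: `A_O`, `B_I`). -/
noncomputable def trAIBO (M : Mat4 dA dBI dBO) :
    Matrix (Fin dA × Fin dBI) (Fin dA × Fin dBI) ℂ :=
  Matrix.of fun p q => ∑ ai : Fin dA, ∑ bo : Fin dBO, M (ai, p.1, p.2, bo) (ai, q.1, q.2, bo)

/-- `L_V := {X : Tr_{A_I A_O B_O}(X) = (Tr(X)/d_{B_I})·I_{B_I}}`. -/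
def LV : Set (Mat4 dA dBI dBO) :=
  {X | trAIAOBO dA dBI dBO X =
    (X.trace / (dBI : ℂ)) • (1 : Matrix (Fin dBI) (Fin dBI) ℂ)}

/-- `L_f := {Y : Tr_{B_O}(Y) = Tr_{A_O B_O}(Y) ⊗ I_{A_O}/d_A}` (factors reinserted in
their original positions). -/
def LF : Set (Mat4 dA dBI dBO) :=
  {Y | trBO dA dBI dBO Y = Matrix.of fun p q =>
    trAOBO dA dBI dBO Y (p.1, p.2.2) (q.1, q.2.2) *
      (if p.2.1 = q.2.1 then ((dA : ℂ))⁻¹ else 0)}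

/-- `L_b := {Z : Tr_{B_O}(Z) = Tr_{A_I B_O}(Z) ⊗ I_{A_I}/d_A}` (factors reinserted in
their original positions). -/
def LB : Set (Mat4 dA dBI dBO) :=
  {Z | trBO dA dBI dBO Z = Matrix.of fun p q =>
    trAIBO dA dBI dBO Z (p.2.1, p.2.2) (q.2.1, q.2.2) *
      (if p.1 = q.1 then ((dA : ℂ))⁻¹ else 0)}

/-- The cone of definite-input-output-direction setups,
`coni(S_definite) := {X + Y : X ∈ P∩L_V∩L_f, Y ∈ P∩L_V∩L_b}`. -/
def coniSdefinite : Set (Mat4 dA dBI dBO) :=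
  {S | ∃ X Y : Mat4 dA dBI dBO,
    X.PosSemidef ∧ X ∈ LV dA dBI dBO ∧ X ∈ LF dA dBI dBO ∧
    Y.PosSemidef ∧ Y ∈ LV dA dBI dBO ∧ Y ∈ LB dA dBI dBO ∧
    S = X + Y}

end InOutIndef

namespace InOutIndef

variable (dA dBI dBO : ℕ)

/-- `⌊S⌋_{A_O}`: trace out `A_O` and reinsert the normalized identity `I_{A_O}/d_A`. -/
noncomputable def floorAO (M : Mat4 dA dBI dBO) : Mat4 dA dBI dBO :=
  Matrix.of fun p q =>
    (if p.2.1 = q.2.1 then ((dA : ℂ))⁻¹ else 0) *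
      ∑ x : Fin dA, M (p.1, x, p.2.2.1, p.2.2.2) (q.1, x, q.2.2.1, q.2.2.2)

/-- `⌊S⌋_{B_O}`: trace out `B_O` and reinsert the normalized identity `I_{B_O}/d_{B_O}`. -/
noncomputable def floorBO (M : Mat4 dA dBI dBO) : Mat4 dA dBI dBO :=
  Matrix.of fun p q =>
    (if p.2.2.2 = q.2.2.2 then ((dBO : ℂ))⁻¹ else 0) *
      ∑ y : Fin dBO, M (p.1, p.2.1, p.2.2.1, y) (q.1, q.2.1, q.2.2.1, y)

/-- `⌊S⌋_{B_O A_O}`: trace out `B_O` and `A_O`, reinserting normalized identities. -/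
noncomputable def floorBOAO (M : Mat4 dA dBI dBO) : Mat4 dA dBI dBO :=
  Matrix.of fun p q =>
    (if p.2.1 = q.2.1 then ((dA : ℂ))⁻¹ else 0) *
      (if p.2.2.2 = q.2.2.2 then ((dBO : ℂ))⁻¹ else 0) *
      ∑ x : Fin dA, ∑ y : Fin dBO, M (p.1, x, p.2.2.1, y) (q.1, x, q.2.2.1, y)

/-- `⌊S⌋_{B_O A_I}`: trace out `B_O` and `A_I`, reinserting normalized identities. -/
noncomputable def floorBOAI (M : Mat4 dA dBI dBO) : Mat4 dA dBI dBO :=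
  Matrix.of fun p q =>
    (if p.1 = q.1 then ((dA : ℂ))⁻¹ else 0) *
      (if p.2.2.2 = q.2.2.2 then ((dBO : ℂ))⁻¹ else 0) *
      ∑ x : Fin dA, ∑ y : Fin dBO, M (x, p.2.1, p.2.2.1, y) (x, q.2.1, q.2.2.1, y)

/-- `⌊S⌋_{B_O A_O A_I}`: trace out `B_O`, `A_O` and `A_I`, reinserting normalized
identities. -/
noncomputable def floorBOAOAI (M : Mat4 dA dBI dBO) : Mat4 dA dBI dBO :=
  Matrix.of fun p q =>
    (if p.1 = q.1 then ((dA : ℂ))⁻¹ else 0) *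
      (if p.2.1 = q.2.1 then ((dA : ℂ))⁻¹ else 0) *
      (if p.2.2.2 = q.2.2.2 then ((dBO : ℂ))⁻¹ else 0) *
      ∑ x : Fin dA, ∑ x' : Fin dA, ∑ y : Fin dBO,
        M (x, x', p.2.2.1, y) (x, x', q.2.2.1, y)

/-- `L_s := {S : ⌊S⌋_{B_O} = ⌊S⌋_{B_O A_O} + ⌊S⌋_{B_O A_I} − ⌊S⌋_{B_O A_O A_I}}`. -/
def LS : Set (Mat4 dA dBI dBO) :=
  {S | floorBO dA dBI dBO S =
    floorBOAO dA dBI dBO S + floorBOAI dA dBI dBO S - floorBOAOAI dA dBI dBO S}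

/-- The Hilbert–Schmidt (Frobenius) norm `‖S‖₂ := √(Tr(SᴴS))`. -/
noncomputable def hsNorm {ι : Type*} [Fintype ι] (M : Matrix ι ι ℂ) : ℝ :=
  Real.sqrt ((Mᴴ * M).trace.re)

end InOutIndef

namespace InOutIndef

/-- A positive semidefinite matrix is bounded above by its trace times the identity. -/
theorem posSemidef_smul_one_sub_of_trace_le {ι : Type*} [Fintype ι] [DecidableEq ι]
    {A : Matrix ι ι ℂ} (hA : A.PosSemidef) {c : ℝ} (hc : A.trace ≤ (c : ℂ)) :
    ((c : ℂ) • (1 : Matrix ι ι ℂ) - A).PosSemidef := by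
  have hsum : ∑ i, hA.1.eigenvalues i ≤ c := by
    rw [hA.1.trace_eq_sum_eigenvalues, RCLike.ofReal_eq_complex_ofReal,
      ← Complex.ofReal_sum] at hc
    exact Complex.real_le_real.1 hc
  have hdiag : ((c : ℂ) • (1 : Matrix ι ι ℂ) -
      diagonal (RCLike.ofReal ∘ hA.1.eigenvalues)).PosSemidef := by
    rw [← diagonal_one, ← diagonal_smul, diagonal_sub]
    refine PosSemidef.diagonal fun i => ?_
    have hi := (Finset.single_le_sum (fun j _ => hA.eigenvalues_nonneg j)
      (Finset.mem_univ i)).trans hsum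
    simpa using hi
  have h := hdiag.mul_mul_conjTranspose_same
    (hA.1.eigenvectorUnitary : Matrix ι ι ℂ)
  have heq : (c : ℂ) • (1 : Matrix ι ι ℂ) - A =
      (hA.1.eigenvectorUnitary : Matrix ι ι ℂ) * ((c : ℂ) • (1 : Matrix ι ι ℂ) -
        diagonal (RCLike.ofReal ∘ hA.1.eigenvalues)) *
        (hA.1.eigenvectorUnitary : Matrix ι ι ℂ)ᴴ := by
    conv_lhs => rw [hA.1.spectral_theorem, Unitary.conjStarAlgAut_apply]
    have hU : (hA.1.eigenvectorUnitary : Matrix ι ι ℂ) *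
        (hA.1.eigenvectorUnitary : Matrix ι ι ℂ)ᴴ = 1 :=
      Unitary.coe_mul_star_self hA.1.eigenvectorUnitary
    rw [mul_sub, sub_mul, mul_smul_comm, mul_one, smul_mul_assoc, hU]
    rfl
  rw [heq]
  exact h

section

variable {dA dBI dBO : ℕ}

theorem floorAO_posSemidef {S : Mat4 dA dBI dBO} (hS : S.PosSemidef) :
    (floorAO dA dBI dBO S).PosSemidef := by
  have h : floorAO dA dBI dBO S = ((dA : ℂ))⁻¹ • ∑ x : Fin dA, ∑ a : Fin dA,
      diagonal (fun p : Idx4 dA dBI dBO => if p.2.1 = a then (1 : ℂ) else 0) *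
        S.submatrix (fun p => (p.1, x, p.2.2)) (fun p => (p.1, x, p.2.2)) *
        (diagonal (fun p : Idx4 dA dBI dBO => if p.2.1 = a then (1 : ℂ) else 0))ᴴ := by
    ext p q
    simp only [floorAO, of_apply, Matrix.smul_apply, Matrix.sum_apply, diagonal_conjTranspose,
      mul_diagonal, diagonal_mul, submatrix_apply, Pi.star_apply, smul_eq_mul]
    by_cases hpq : p.2.1 = q.2.1
    · simp [hpq]
    · simp [hpq]
  rw [h]
  refine PosSemidef.smul (posSemidef_sum _ fun x _ => posSemidef_sum _ fun a _ =>
    (hS.submatrix _).mul_mul_conjTranspose_same _) ?_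
  exact inv_nonneg.2 (Nat.cast_nonneg _)

theorem trAIAOBO_floorAO (hdA : dA ≠ 0) (S : Mat4 dA dBI dBO) :
    trAIAOBO dA dBI dBO (floorAO dA dBI dBO S) = trAIAOBO dA dBI dBO S := by
  have hA : (dA : ℂ) ≠ 0 := Nat.cast_ne_zero.2 hdA
  ext b b'
  simp only [trAIAOBO, floorAO, of_apply, if_true, ← Finset.mul_sum, Finset.sum_const,
    Finset.card_univ, Fintype.card_fin, nsmul_eq_mul]
  rw [Finset.mul_sum, Finset.mul_sum]
  refine Finset.sum_congr rfl fun i _ => ?_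
  rw [inv_mul_cancel_left₀ hA, Finset.sum_comm]

theorem trace_trAIAOBO (S : Mat4 dA dBI dBO) :
    (trAIAOBO dA dBI dBO S).trace = S.trace := by
  simp only [trAIAOBO, Matrix.trace, diag_apply, of_apply, Fintype.sum_prod_type]
  rw [Finset.sum_comm]
  refine Finset.sum_congr rfl fun i _ => ?_
  rw [Finset.sum_comm]

theorem trace_floorAO (hdA : dA ≠ 0) (S : Mat4 dA dBI dBO) :
    (floorAO dA dBI dBO S).trace = S.trace := by
  rw [← trace_trAIAOBO, trAIAOBO_floorAO hdA, trace_trAIAOBO]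

theorem floorAO_mem_LV (hdA : dA ≠ 0) {S : Mat4 dA dBI dBO} (hS : S ∈ LV dA dBI dBO) :
    floorAO dA dBI dBO S ∈ LV dA dBI dBO := by
  simpa only [LV, Set.mem_ofPred_eq, trAIAOBO_floorAO hdA, trace_floorAO hdA] using hS

theorem floorAO_mem_LF (hdA : dA ≠ 0) (S : Mat4 dA dBI dBO) :
    floorAO dA dBI dBO S ∈ LF dA dBI dBO := by
  have hA : (dA : ℂ) ≠ 0 := Nat.cast_ne_zero.2 hdA
  ext ⟨i, o, b⟩ ⟨i', o', b'⟩
  by_cases ho : o = o'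
  · simp [trBO, trAOBO, floorAO, ho, ← Finset.mul_sum, hA, mul_comm]
  · simp [trBO, trAOBO, floorAO, ho]

theorem add_mem_LV {X Y : Mat4 dA dBI dBO} (hX : X ∈ LV dA dBI dBO)
    (hY : Y ∈ LV dA dBI dBO) : X + Y ∈ LV dA dBI dBO := by
  have h : trAIAOBO dA dBI dBO (X + Y) = trAIAOBO dA dBI dBO X + trAIAOBO dA dBI dBO Y := by
    ext; simp [trAIAOBO, Finset.sum_add_distrib]
  simp only [LV, Set.mem_ofPred_eq] at hX hY ⊢
  rw [h, hX, hY, trace_add, add_div, add_smul]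

theorem smul_mem_LV (c : ℂ) {X : Mat4 dA dBI dBO} (hX : X ∈ LV dA dBI dBO) :
    c • X ∈ LV dA dBI dBO := by
  have h : trAIAOBO dA dBI dBO (c • X) = c • trAIAOBO dA dBI dBO X := by
    ext; simp [trAIAOBO, Finset.mul_sum]
  simp only [LV, Set.mem_ofPred_eq] at hX ⊢
  rw [h, hX, trace_smul, smul_smul, smul_eq_mul, mul_div_assoc]

theorem one_mem_LV (hdBI : dBI ≠ 0) : (1 : Mat4 dA dBI dBO) ∈ LV dA dBI dBO := by
  have hB : (dBI : ℂ) ≠ 0 := Nat.cast_ne_zero.2 hdBI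
  ext b b'
  by_cases h : b = b'
  · subst h
    simp [trAIAOBO]
    field_simp
  · simp [trAIAOBO, one_apply, h]

theorem add_mem_LB {X Y : Mat4 dA dBI dBO} (hX : X ∈ LB dA dBI dBO)
    (hY : Y ∈ LB dA dBI dBO) : X + Y ∈ LB dA dBI dBO := by
  ext p q
  have h := congr_arg₂ (· + ·) (congr_fun₂ hX p q) (congr_fun₂ hY p q)
  simpa only [trBO, trAIBO, of_apply, Matrix.add_apply, Finset.sum_add_distrib, add_mul] using h

theorem smul_mem_LB (c : ℂ) {X : Mat4 dA dBI dBO} (hX : X ∈ LB dA dBI dBO) :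
    c • X ∈ LB dA dBI dBO := by
  ext p q
  have h := congr_arg (c * ·) (congr_fun₂ hX p q)
  simpa only [trBO, trAIBO, of_apply, Matrix.smul_apply, smul_eq_mul, ← Finset.mul_sum,
    mul_assoc] using h

theorem one_mem_LB (hdA : dA ≠ 0) : (1 : Mat4 dA dBI dBO) ∈ LB dA dBI dBO := by
  have hA : (dA : ℂ) ≠ 0 := Nat.cast_ne_zero.2 hdA
  ext ⟨i, o, b⟩ ⟨i', o', b'⟩
  by_cases hi : i = i' <;> by_cases ho : o = o' <;> by_cases hb : b = b' <;>
    simp [trBO, trAIBO, one_apply, hi, ho, hb]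
  field_simp

theorem sub_floorAO_mem_LB (hdBO : dBO ≠ 0) {S : Mat4 dA dBI dBO}
    (hS : S ∈ LS dA dBI dBO) : S - floorAO dA dBI dBO S ∈ LB dA dBI dBO := by
  have hB : (dBO : ℂ) ≠ 0 := Nat.cast_ne_zero.2 hdBO
  ext ⟨i, o, b⟩ ⟨i', o', b'⟩
  let y : Fin dBO := ⟨0, Nat.pos_of_ne_zero hdBO⟩
  have h := congr_fun₂ hS (i, o, b, y) (i', o', b', y)
  simp only [floorBO, floorBOAO, floorBOAI, floorBOAOAI, of_apply, Matrix.add_apply, Matrix.sub_apply,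
    if_true] at h
  simp only [trBO, trAIBO, floorAO, of_apply, Matrix.sub_apply, Finset.sum_sub_distrib]
  have hcomm : ∑ y : Fin dBO, ∑ x : Fin dA, S (i, x, b, y) (i', x, b', y) =
      ∑ x : Fin dA, ∑ y : Fin dBO, S (i, x, b, y) (i', x, b', y) := Finset.sum_comm
  have hcomm' : ∑ j : Fin dA, ∑ y : Fin dBO, ∑ x : Fin dA, S (j, x, b, y) (j, x, b', y) =
      ∑ j : Fin dA, ∑ x : Fin dA, ∑ y : Fin dBO, S (j, x, b, y) (j, x, b', y) :=
    Finset.sum_congr rfl fun _ _ => Finset.sum_comm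
  refine mul_left_cancel₀ (inv_ne_zero hB) ?_
  by_cases ho : o = o'
  · simp only [ho, if_true, ← Finset.mul_sum, hcomm, hcomm'] at h ⊢
    linear_combination h
  · simp only [ho, if_false, zero_mul, mul_zero, Finset.sum_const_zero] at h ⊢
    linear_combination h

end

/-- If `S` is a positive semidefinite operator in `L_s ∩ L_V`, then for every real
`λ ≥ 2·Tr(S)` the operator `S + λI` belongs to `coni(S_definite)`. In particular, if
`Tr(S) = d_A·d_{B_I}` (the normalization of a setup operator), then
`S + λI ∈ coni(S_definite)` for all `λ ≥ 2·d_A·d_{B_I}`. -/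
theorem add_scaled_id_mem_coniSdefinite (dA dBI dBO : ℕ)
    (hdA : 1 ≤ dA) (hdBI : 1 ≤ dBI) (hdBO : 1 ≤ dBO)
    (S : Mat4 dA dBI dBO) (hS : S.PosSemidef)
    (hLs : S ∈ LS dA dBI dBO) (hLV : S ∈ LV dA dBI dBO) :
    (∀ lam : ℝ, 2 * S.trace ≤ (lam : ℂ) →
      S + (lam : ℂ) • 1 ∈ coniSdefinite dA dBI dBO) ∧
    (S.trace = (dA : ℂ) * (dBI : ℂ) →
      ∀ lam : ℝ, 2 * ((dA : ℝ) * (dBI : ℝ)) ≤ lam →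
        S + (lam : ℂ) • 1 ∈ coniSdefinite dA dBI dBO) := by
  have hA : dA ≠ 0 := Nat.one_le_iff_ne_zero.1 hdA
  have hBI : dBI ≠ 0 := Nat.one_le_iff_ne_zero.1 hdBI
  have hBO : dBO ≠ 0 := Nat.one_le_iff_ne_zero.1 hdBO
  have key : ∀ lam : ℝ, 2 * S.trace ≤ (lam : ℂ) →
      S + (lam : ℂ) • 1 ∈ coniSdefinite dA dBI dBO := by
    intro lam hlam
    have htr : (floorAO dA dBI dBO S).trace ≤ (lam : ℂ) := by
      rw [trace_floorAO hA]
      refine le_trans ?_ hlam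
      rw [two_mul]
      exact le_add_of_nonneg_left hS.trace_nonneg
    have hFV := floorAO_mem_LV hA hLV
    refine ⟨floorAO dA dBI dBO S, S - floorAO dA dBI dBO S + (lam : ℂ) • 1,
      floorAO_posSemidef hS, hFV, floorAO_mem_LF hA S, ?_, ?_, ?_, by abel⟩
    · have h := hS.add (posSemidef_smul_one_sub_of_trace_le (floorAO_posSemidef hS) htr)
      rwa [add_sub_left_comm, add_comm] at h
    · rw [sub_eq_add_neg, ← neg_one_smul ℂ]
      exact add_mem_LV (add_mem_LV hLV (smul_mem_LV _ hFV)) (smul_mem_LV _ (one_mem_LV hBI))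
    · exact add_mem_LB (sub_floorAO_mem_LB hBO hLs) (smul_mem_LB _ (one_mem_LB hA))
  refine ⟨key, fun htr lam hlam => key lam ?_⟩
  rw [htr]
  exact_mod_cast hlam

end InOutIndef
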